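/- Let n ≥ 3, let α, β, γ, ν, μ be real numbers and 1 < q < ∞, and assume μ > 0. If the operator S = S_{α,β,γ} is bounded from L^1_ν(Λ_n) into L^q_μ(Λ_n), then the parameters satisfy: (i) γ = α + β + n/2 − ν + μ/q; (ii) γ > 0; (iii) n/2 − 1 − qα < μ < q(γ − α) − n/2 + 1. (This is the necessity lemma, Lemma 4.5 of the paper, instantiated on the rank-2 Lorentz cone, where n/r = n/2.) -/

import Mathlib

open MeasureTheory ENNReal

noncomputable section

/-- The Lorentz determinant `Δ(y) = y₁² − y₂² − ⋯ − y_n²`. -/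
def lDelta (n : ℕ) [NeZero n] (y : Fin n → ℝ) : ℝ :=
  2 * y 0 ^ 2 - ∑ i, y i ^ 2

/-- The Lorentz cone `Λ_n`. -/
def lCone (n : ℕ) [NeZero n] : Set (Fin n → ℝ) :=
  {y | 0 < lDelta n y ∧ 0 < y 0}

/-- The `L^p_ν(Λ_n)` norm `(∫_{Λ_n} |g(y)|^p Δ(y)^{ν−n/2} dy)^{1/p}`. -/
def coneNorm (n : ℕ) [NeZero n] (p ν : ℝ) (g : (Fin n → ℝ) → ℝ) : ℝ≥0∞ :=
  (∫⁻ y in lCone n, ENNReal.ofReal (|g y| ^ p * lDelta n y ^ (ν - (n : ℝ) / 2))) ^ (1 / p)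

/-- The operator `S_{α,β,γ}` applied to `|g|`:
`S|g|(y) = Δ(y)^α ∫_{Λ_n} Δ(y+x)^{−γ} |g(x)| Δ(x)^β dx`. -/
def Sop (n : ℕ) [NeZero n] (α β γ : ℝ) (g : (Fin n → ℝ) → ℝ) (y : Fin n → ℝ) : ℝ≥0∞ :=
  ENNReal.ofReal (lDelta n y ^ α) *
    ∫⁻ x in lCone n, ENNReal.ofReal (lDelta n (y + x) ^ (-γ) * |g x| * lDelta n x ^ β)

/-- The `L^q_μ(Λ_n)` norm of `S_{α,β,γ}|g|`. -/
def SopNorm (n : ℕ) [NeZero n] (α β γ q μ : ℝ) (g : (Fin n → ℝ) → ℝ) : ℝ≥0∞ :=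
  (∫⁻ y in lCone n, Sop n α β γ g y ^ q * ENNReal.ofReal (lDelta n y ^ (μ - (n : ℝ) / 2))) ^ (1 / q)

/-- `S_{α,β,γ}` is bounded from `L^p_ν(Λ_n)` to `L^q_μ(Λ_n)`:
`‖S|g|‖_{q,μ} ≤ C ‖g‖_{p,ν}` for every `g ∈ L^p_ν(Λ_n)`. -/
def SBounded (n : ℕ) [NeZero n] (α β γ p ν q μ : ℝ) : Prop :=
  ∃ C > (0 : ℝ), ∀ g : (Fin n → ℝ) → ℝ, Measurable g → coneNorm n p ν g < ⊤ →
    SopNorm n α β γ q μ g ≤ ENNReal.ofReal C * coneNorm n p ν g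

theorem measurable_lDelta (n : ℕ) [NeZero n] : Measurable (lDelta n) := by
  unfold lDelta
  fun_prop

theorem measurableSet_lCone (n : ℕ) [NeZero n] : MeasurableSet (lCone n) :=
  (measurableSet_lt measurable_const (measurable_lDelta n)).inter
    (measurableSet_lt measurable_const (measurable_pi_apply 0))

theorem lDelta_smul (n : ℕ) [NeZero n] (t : ℝ) (y : Fin n → ℝ) :
    lDelta n (t • y) = t ^ 2 * lDelta n y := by
  simp only [lDelta, Pi.smul_apply, smul_eq_mul, mul_pow, ← Finset.mul_sum]
  ring

theorem smul_mem_lCone_iff {n : ℕ} [NeZero n] {t : ℝ} (ht : 0 < t) {y : Fin n → ℝ} :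
    t • y ∈ lCone n ↔ y ∈ lCone n := by
  simp only [lCone, Set.mem_ofPred_eq, lDelta_smul, Pi.smul_apply, smul_eq_mul]
  rw [mul_pos_iff_of_pos_left (by positivity), mul_pos_iff_of_pos_left ht]

theorem lintegral_lCone_smul (n : ℕ) [NeZero n] {t : ℝ} (ht : 0 < t)
    (f : (Fin n → ℝ) → ℝ≥0∞) :
    ∫⁻ y in lCone n, f y = ENNReal.ofReal (t ^ n) * ∫⁻ y in lCone n, f (t • y) := by
  have he : MeasurableEmbedding (fun y : Fin n → ℝ => t • y) :=
    (Homeomorph.smulOfNeZero t ht.ne').measurableEmbedding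
  have hpre : (fun y : Fin n → ℝ => t • y) ⁻¹' lCone n = lCone n :=
    Set.ext fun y => smul_mem_lCone_iff ht
  have h := Measure.map_addHaar_smul (volume : Measure (Fin n → ℝ)) ht.ne'
  have h2 : ∫⁻ y in lCone n, f (t • y) = ENNReal.ofReal (t ^ n)⁻¹ * ∫⁻ y in lCone n, f y := by
    calc ∫⁻ y in lCone n, f (t • y)
        = ∫⁻ y in (fun y : Fin n → ℝ => t • y) ⁻¹' lCone n, f (t • y) := by rw [hpre]
      _ = ∫⁻ y in lCone n, f y ∂(Measure.map (fun y : Fin n → ℝ => t • y) volume) := by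
        rw [he.restrict_map, he.lintegral_map]
      _ = _ := by
        rw [h, Measure.restrict_smul, lintegral_smul_measure]
        simp [abs_of_pos ht]
  rw [h2, ← mul_assoc, ← ENNReal.ofReal_mul (by positivity), mul_inv_cancel₀ (by positivity)]
  simp

theorem pow_eq_sq_rpow_half (n : ℕ) {t : ℝ} (ht : 0 ≤ t) :
    t ^ n = (t ^ 2) ^ ((n : ℝ) / 2) := by
  rw [← Real.rpow_natCast t 2, ← Real.rpow_mul ht, ← Real.rpow_natCast]
  congr 1
  push_cast
  ring

theorem coneNorm_one_smul (n : ℕ) [NeZero n] {ν t : ℝ} (ht : 0 < t) (g : (Fin n → ℝ) → ℝ) :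
    coneNorm n 1 ν (fun x => g (t⁻¹ • x)) = ENNReal.ofReal ((t ^ 2) ^ ν) * coneNorm n 1 ν g := by
  have hT : 0 < t ^ 2 := by positivity
  simp only [coneNorm, Real.rpow_one, div_one, ENNReal.rpow_one]
  rw [lintegral_lCone_smul n ht, pow_eq_sq_rpow_half n ht.le, ← lintegral_const_mul' _ _ ENNReal.ofReal_ne_top,
    ← lintegral_const_mul' _ _ ENNReal.ofReal_ne_top]
  refine setLIntegral_congr_fun (measurableSet_lCone n) fun y hy => ?_
  rw [← ENNReal.ofReal_mul (by positivity), ← ENNReal.ofReal_mul (by positivity), lDelta_smul,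
    Real.mul_rpow hT.le hy.1.le, inv_smul_smul₀ ht.ne',
    show ν = (n : ℝ) / 2 + (ν - (n : ℝ) / 2) by ring, Real.rpow_add hT]
  ring_nf

theorem Sop_smul (n : ℕ) [NeZero n] {α β γ t : ℝ} (ht : 0 < t) (g : (Fin n → ℝ) → ℝ)
    {y : Fin n → ℝ} (hy : y ∈ lCone n)
    (hadd : ∀ x ∈ lCone n, 0 ≤ lDelta n (y + x)) :
    Sop n α β γ (fun x => g (t⁻¹ • x)) (t • y) =
      ENNReal.ofReal ((t ^ 2) ^ (α - γ + β + (n : ℝ) / 2)) * Sop n α β γ g y := by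
  have hT : 0 < t ^ 2 := by positivity
  simp only [Sop]
  rw [lintegral_lCone_smul n ht, pow_eq_sq_rpow_half n ht.le, lDelta_smul, Real.mul_rpow hT.le hy.1.le, ← mul_assoc,
    ← mul_assoc, ← ENNReal.ofReal_mul (by have := Real.rpow_nonneg hy.1.le α; positivity),
    ← ENNReal.ofReal_mul (by positivity),
    ← lintegral_const_mul' _ _ ENNReal.ofReal_ne_top,
    ← lintegral_const_mul' _ _ ENNReal.ofReal_ne_top]
  refine setLIntegral_congr_fun (measurableSet_lCone n) fun x hx => ?_
  have h1 := Real.rpow_nonneg hy.1.le α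
  rw [← ENNReal.ofReal_mul (by positivity), ← ENNReal.ofReal_mul (by positivity), ← smul_add, lDelta_smul,
    lDelta_smul, Real.mul_rpow hT.le (hadd x hx), Real.mul_rpow hT.le hx.1.le, inv_smul_smul₀ ht.ne',
    Real.rpow_add hT, Real.rpow_add hT, sub_eq_add_neg, Real.rpow_add hT]
  ring_nf

theorem SopNorm_smul (n : ℕ) [NeZero n] {α β γ q μ t : ℝ} (hq : 0 < q) (ht : 0 < t)
    (g : (Fin n → ℝ) → ℝ)
    (hadd : ∀ y ∈ lCone n, ∀ x ∈ lCone n, 0 ≤ lDelta n (y + x)) :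
    SopNorm n α β γ q μ (fun x => g (t⁻¹ • x)) =
      ENNReal.ofReal ((t ^ 2) ^ (α - γ + β + (n : ℝ) / 2 + μ / q)) * SopNorm n α β γ q μ g := by
  have hT : 0 < t ^ 2 := by positivity
  have key : ENNReal.ofReal ((t ^ 2) ^ (α - γ + β + (n : ℝ) / 2 + μ / q)) =
      ENNReal.ofReal ((t ^ 2) ^ ((α - γ + β + (n : ℝ) / 2) * q + μ)) ^ (1 / q) := by
    rw [ENNReal.ofReal_rpow_of_nonneg (by positivity) (by positivity), ← Real.rpow_mul hT.le]
    congr 2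
    field_simp
  unfold SopNorm
  rw [key, ← ENNReal.mul_rpow_of_nonneg _ _ (by positivity), lintegral_lCone_smul n ht, pow_eq_sq_rpow_half n ht.le,
    ← lintegral_const_mul' _ _ ENNReal.ofReal_ne_top,
    ← lintegral_const_mul' _ _ ENNReal.ofReal_ne_top]
  congr 1
  refine setLIntegral_congr_fun (measurableSet_lCone n) fun y hy => ?_
  rw [Sop_smul n ht g hy (hadd y hy), lDelta_smul, Real.mul_rpow hT.le hy.1.le,
    ENNReal.mul_rpow_of_nonneg _ _ hq.le,
    ENNReal.ofReal_rpow_of_nonneg (by positivity) hq.le, ← Real.rpow_mul hT.le,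
    ENNReal.ofReal_mul (by positivity),
    show (α - γ + β + (n : ℝ) / 2) * q + μ =
      (n : ℝ) / 2 + (α - γ + β + (n : ℝ) / 2) * q + (μ - (n : ℝ) / 2) by ring,
    Real.rpow_add hT, Real.rpow_add hT, ENNReal.ofReal_mul (by positivity), ENNReal.ofReal_mul (by positivity)]
  ring

/-- The projection of `ℝ^{m+1}` to the last `m` coordinates, with the Euclidean norm. -/
def spatial {m : ℕ} (y : Fin (m + 1) → ℝ) : EuclideanSpace ℝ (Fin m) :=
  WithLp.toLp 2 (Fin.tail y)

theorem continuous_spatial {m : ℕ} : Continuous (spatial : (Fin (m + 1) → ℝ) → _) := by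
  unfold spatial Fin.tail
  fun_prop

@[fun_prop]
theorem measurable_spatial {m : ℕ} : Measurable (spatial : (Fin (m + 1) → ℝ) → _) :=
  continuous_spatial.measurable

theorem spatial_add {m : ℕ} (x y : Fin (m + 1) → ℝ) : spatial (x + y) = spatial x + spatial y :=
  rfl

theorem lDelta_eq_sq_sub {m : ℕ} (y : Fin (m + 1) → ℝ) :
    lDelta (m + 1) y = y 0 ^ 2 - ‖spatial y‖ ^ 2 := by
  rw [lDelta, EuclideanSpace.real_norm_sq_eq, Fin.sum_univ_succ]
  simp only [spatial, Fin.tail]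
  ring

theorem mem_lCone_iff {m : ℕ} {y : Fin (m + 1) → ℝ} :
    y ∈ lCone (m + 1) ↔ ‖spatial y‖ < y 0 := by
  simp only [lCone, Set.mem_ofPred_eq, lDelta_eq_sq_sub]
  have := norm_nonneg (spatial y)
  constructor
  · rintro ⟨h1, h2⟩
    nlinarith
  · intro h
    constructor <;> nlinarith

theorem lCone_add_mem {m : ℕ} {x y : Fin (m + 1) → ℝ} (hx : x ∈ lCone (m + 1))
    (hy : y ∈ lCone (m + 1)) : x + y ∈ lCone (m + 1) := by
  rw [mem_lCone_iff] at *
  rw [spatial_add, Pi.add_apply]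
  linarith [norm_add_le (spatial x) (spatial y)]

/-- Light-cone coordinates `y ↦ (y', y₁ - |y'|)`. -/
def shear {m : ℕ} (y : Fin (m + 1) → ℝ) : EuclideanSpace ℝ (Fin m) × ℝ :=
  (spatial y, y 0 - ‖spatial y‖)

theorem continuous_shear {m : ℕ} :
    Continuous (shear : (Fin (m + 1) → ℝ) → EuclideanSpace ℝ (Fin m) × ℝ) :=
  continuous_spatial.prodMk ((continuous_apply 0).sub continuous_spatial.norm)

theorem measurePreserving_shear (m : ℕ) :
    MeasurePreserving (shear : (Fin (m + 1) → ℝ) → EuclideanSpace ℝ (Fin m) × ℝ) := by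
  have h1 := volume_preserving_piFinSuccAbove (fun _ : Fin (m + 1) => ℝ) 0
  have h2 : MeasurePreserving (Prod.swap : ℝ × (Fin m → ℝ) → _) :=
    Measure.measurePreserving_swap
  have h3 : MeasurePreserving (fun p : (Fin m → ℝ) × ℝ =>
      ((WithLp.toLp 2 p.1 : EuclideanSpace ℝ (Fin m)),
        p.2 - ‖(WithLp.toLp 2 p.1 : EuclideanSpace ℝ (Fin m))‖)) := by
    refine (PiLp.volume_preserving_toLp (Fin m)).skew_product
      (g := fun a c => c - ‖(WithLp.toLp 2 a : EuclideanSpace ℝ (Fin m))‖) ?_ ?_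
    · unfold Function.uncurry
      fun_prop
    · exact Filter.Eventually.of_forall fun a => (measurePreserving_sub_right volume _).map_eq
  exact h3.comp (h2.comp h1)

theorem rpow_bounds_of_lintegral_ne_top {m : ℕ} (hm : 1 ≤ m) {s τ : ℝ}
    (h : ∫⁻ y in shear ⁻¹' (({z | 1 < ‖z‖} : Set (EuclideanSpace ℝ (Fin m))) ×ˢ Set.Ioo (0 : ℝ) 2),
      ENNReal.ofReal (‖(shear y).1‖ ^ τ) * ENNReal.ofReal ((shear y).2 ^ s) ≠ ⊤) :
    -1 < s ∧ τ < -m := by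
  have : Nonempty (Fin m) := ⟨⟨0, hm⟩⟩
  have hB : MeasurableSet {z : EuclideanSpace ℝ (Fin m) | 1 < ‖z‖} :=
    measurableSet_lt measurable_const measurable_norm
  have hBo : IsOpen {z : EuclideanSpace ℝ (Fin m) | 1 < ‖z‖} :=
    isOpen_lt continuous_const continuous_norm
  rw [(measurePreserving_shear m).setLIntegral_comp_preimage (hB.prod measurableSet_Ioo)
    (f := fun p => ENNReal.ofReal (‖p.1‖ ^ τ) * ENNReal.ofReal (p.2 ^ s)) (by fun_prop),
    Measure.volume_eq_prod, ← Measure.prod_restrict,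
    lintegral_prod_mul (f := fun z : EuclideanSpace ℝ (Fin m) => ENNReal.ofReal (‖z‖ ^ τ))
      (g := fun u : ℝ => ENNReal.ofReal (u ^ s)) (by fun_prop) (by fun_prop)] at h
  have hu : ∫⁻ u in Set.Ioo (0 : ℝ) 2, ENNReal.ofReal (u ^ s) ≠ 0 := by
    refine ((setLIntegral_pos_iff (by fun_prop)).2 ?_).ne'
    have : Set.Ioo (0 : ℝ) 2 ⊆
        (Function.support fun u : ℝ => ENNReal.ofReal (u ^ s)) ∩ Set.Ioo (0 : ℝ) 2 := fun u hu =>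
      ⟨(ENNReal.ofReal_pos.2 (Real.rpow_pos_of_pos hu.1 s)).ne', hu⟩
    exact lt_of_lt_of_le (by simp) (measure_mono this)
  have hz : ∫⁻ z in {z : EuclideanSpace ℝ (Fin m) | 1 < ‖z‖}, ENNReal.ofReal (‖z‖ ^ τ) ≠ 0 := by
    refine ((setLIntegral_pos_iff (by fun_prop)).2 ?_).ne'
    have : {z : EuclideanSpace ℝ (Fin m) | 1 < ‖z‖} ⊆
        (Function.support fun z : EuclideanSpace ℝ (Fin m) => ENNReal.ofReal (‖z‖ ^ τ)) ∩
          {z : EuclideanSpace ℝ (Fin m) | 1 < ‖z‖} := fun z hz =>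
      ⟨(ENNReal.ofReal_pos.2 (Real.rpow_pos_of_pos (one_pos.trans hz) τ)).ne', hz⟩
    refine lt_of_lt_of_le (hBo.measure_pos volume ?_) (measure_mono this)
    obtain ⟨z, hz⟩ := NormedSpace.exists_lt_norm ℝ (EuclideanSpace ℝ (Fin m)) 1
    exact ⟨z, hz⟩
  have hu' := (ENNReal.lt_top_of_mul_ne_top_right h hz).ne
  have hz' := (ENNReal.lt_top_of_mul_ne_top_left h hu).ne
  constructor
  · rw [← intervalIntegral.integrableOn_Ioo_rpow_iff two_pos]
    refine (lintegral_ofReal_ne_top_iff_integrable (by fun_prop) ?_).1 hu'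
    exact (ae_restrict_mem measurableSet_Ioo).mono fun u hu => Real.rpow_nonneg hu.1.le s
  · have hi : IntegrableOn (fun z : EuclideanSpace ℝ (Fin m) => ‖z‖ ^ τ) {z | 1 < ‖z‖} :=
      (lintegral_ofReal_ne_top_iff_integrable
        (by fun_prop : Measurable fun z : EuclideanSpace ℝ (Fin m) => ‖z‖ ^ τ).aestronglyMeasurable
        (Filter.Eventually.of_forall fun z => by positivity)).1 hz'
    have hi2 : Integrable (fun z : EuclideanSpace ℝ (Fin m) =>
        (Set.Ioi (1 : ℝ)).indicator (fun r : ℝ => r ^ τ) ‖z‖) :=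
      (integrable_indicator_iff hB).2 hi
    rw [integrable_fun_norm_addHaar] at hi2
    have hi3 : IntegrableOn (fun r : ℝ => r ^ ((m : ℝ) - 1 + τ)) (Set.Ioi 1) := by
      refine ((hi2.mono_set (Set.Ioi_subset_Ioi zero_le_one))).congr_fun (fun r hr => ?_)
        measurableSet_Ioi
      have hr0 : (0 : ℝ) < r := one_pos.trans hr
      simp only [Set.indicator_of_mem hr, smul_eq_mul, finrank_euclideanSpace_fin]
      rw [Real.rpow_add hr0, ← Nat.cast_pred hm, Real.rpow_natCast]
    have := (integrableOn_Ioi_rpow_iff one_pos).1 hi3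
    linarith

/-- A bounded open set, relatively compact in the cone. -/
def testSet (m : ℕ) : Set (Fin (m + 1) → ℝ) :=
  {x | (1 < x 0 ∧ x 0 < 2) ∧ ‖spatial x‖ < 1 / 2}

theorem isOpen_testSet (m : ℕ) : IsOpen (testSet m) :=
  ((isOpen_lt continuous_const (continuous_apply 0)).inter
    (isOpen_lt (continuous_apply 0) continuous_const)).inter
    (isOpen_lt continuous_spatial.norm continuous_const)

theorem testSet_nonempty (m : ℕ) : (testSet m).Nonempty := by
  refine ⟨Fin.cons (3 / 2) 0, ⟨?_, ?_⟩, ?_⟩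
  · simp only [Fin.cons_zero]; norm_num
  · simp only [Fin.cons_zero]; norm_num
  · simp [spatial]

theorem testSet_subset_lCone (m : ℕ) : testSet m ⊆ lCone (m + 1) := by
  rintro x ⟨⟨h1, -⟩, h2⟩
  rw [mem_lCone_iff]
  linarith

theorem volume_testSet_lt_top (m : ℕ) : volume (testSet m) < ⊤ := by
  have hsub : testSet m ⊆ Metric.closedBall 0 2 := by
    rintro x ⟨⟨h1, h2⟩, h3⟩
    rw [mem_closedBall_zero_iff, pi_norm_le_iff_of_nonneg zero_le_two]
    intro i
    refine Fin.cases ?_ (fun j => ?_) i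
    · rw [Real.norm_eq_abs, abs_le]
      constructor <;> linarith
    · have : ‖x j.succ‖ ≤ ‖spatial x‖ := PiLp.norm_apply_le (spatial x) j
      linarith
  exact (measure_mono hsub).trans_lt (isCompact_closedBall _ _).measure_lt_top

theorem lDelta_mem_of_mem_testSet {m : ℕ} {x : Fin (m + 1) → ℝ} (hx : x ∈ testSet m) :
    1 / 8 ≤ lDelta (m + 1) x ∧ lDelta (m + 1) x ≤ 32 * (1 / 8) := by
  obtain ⟨⟨h1, h2⟩, h3⟩ := hx
  rw [lDelta_eq_sq_sub]
  have := norm_nonneg (spatial x)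
  constructor <;> nlinarith

theorem min_mul_rpow_le {r X : ℝ} (e : ℝ) (hr : 0 < r) (h1 : r ≤ X) (h2 : X ≤ 32 * r) :
    min 1 (32 ^ e) * r ^ e ≤ X ^ e := by
  have hre : 0 ≤ r ^ e := by positivity
  rcases le_total 0 e with he | he
  · calc min 1 (32 ^ e) * r ^ e ≤ 1 * r ^ e := by gcongr; exact min_le_left _ _
      _ ≤ X ^ e := by rw [one_mul]; gcongr
  · calc min 1 (32 ^ e) * r ^ e ≤ 32 ^ e * r ^ e := by gcongr; exact min_le_right _ _
      _ = (32 * r) ^ e := (Real.mul_rpow (by norm_num) hr.le).symm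
      _ ≤ X ^ e := Real.rpow_le_rpow_of_nonpos (hr.trans_le h1) h2 he

theorem rpow_le_max_mul {r X : ℝ} (e : ℝ) (hr : 0 < r) (h1 : r ≤ X) (h2 : X ≤ 32 * r) :
    X ^ e ≤ max 1 (32 ^ e) * r ^ e := by
  have hre : 0 ≤ r ^ e := by positivity
  rcases le_total 0 e with he | he
  · calc X ^ e ≤ (32 * r) ^ e := Real.rpow_le_rpow (hr.le.trans h1) h2 he
      _ = 32 ^ e * r ^ e := Real.mul_rpow (by norm_num) hr.le
      _ ≤ max 1 (32 ^ e) * r ^ e := by gcongr; exact le_max_right _ _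
  · calc X ^ e ≤ 1 * r ^ e := by
          rw [one_mul]; exact Real.rpow_le_rpow_of_nonpos hr h1 he
      _ ≤ max 1 (32 ^ e) * r ^ e := by gcongr; exact le_max_left _ _

theorem lDelta_add_bounds {m : ℕ} {x y : Fin (m + 1) → ℝ} (hx : x ∈ testSet m)
    (hr : 1 < ‖spatial y‖) (hu : 0 < y 0 - ‖spatial y‖) (hu2 : y 0 - ‖spatial y‖ < 2) :
    ‖spatial y‖ ≤ lDelta (m + 1) (y + x) ∧ lDelta (m + 1) (y + x) ≤ 32 * ‖spatial y‖ := by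
  obtain ⟨⟨h1, h2⟩, h3⟩ := hx
  have h4 : ‖spatial (y + x)‖ ≤ ‖spatial y‖ + 1 / 2 := by
    rw [spatial_add]; linarith [norm_add_le (spatial y) (spatial x)]
  have h5 : ‖spatial y‖ - 1 / 2 ≤ ‖spatial (y + x)‖ := by
    have := norm_sub_le (spatial (y + x)) (spatial x)
    rw [spatial_add, add_sub_cancel_right] at this
    rw [spatial_add]
    linarith
  rw [lDelta_eq_sq_sub, sq_sub_sq, Pi.add_apply]
  set r := ‖spatial y‖
  set w := ‖spatial (y + x)‖
  constructor
  · calc r = (2 * r) * (1 / 2) := by ring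
      _ ≤ (y 0 + x 0 + w) * (y 0 + x 0 - w) := by gcongr <;> linarith
  · calc (y 0 + x 0 + w) * (y 0 + x 0 - w) ≤ (64 / 9 * r) * (9 / 2) := by
          gcongr <;> linarith
      _ = 32 * r := by ring

theorem lDelta_bounds {m : ℕ} {y : Fin (m + 1) → ℝ}
    (hr : 1 < ‖spatial y‖) (hu : 0 < y 0 - ‖spatial y‖) (hu2 : y 0 - ‖spatial y‖ < 2) :
    (y 0 - ‖spatial y‖) * ‖spatial y‖ ≤ lDelta (m + 1) y ∧
      lDelta (m + 1) y ≤ 32 * ((y 0 - ‖spatial y‖) * ‖spatial y‖) := by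
  rw [lDelta_eq_sq_sub, sq_sub_sq]
  constructor <;> nlinarith [mul_pos hu (one_pos.trans hr)]

/-- The test function. -/
def testFun (m : ℕ) : (Fin (m + 1) → ℝ) → ℝ :=
  (testSet m).indicator 1

theorem measurable_testFun (m : ℕ) : Measurable (testFun m) :=
  measurable_one.indicator (isOpen_testSet m).measurableSet

theorem coneNorm_testFun_lt_top (m : ℕ) (ν : ℝ) : coneNorm (m + 1) 1 ν (testFun m) < ⊤ := by
  simp only [coneNorm, Real.rpow_one, div_one, ENNReal.rpow_one]
  set e := ν - ((m + 1 : ℕ) : ℝ) / 2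
  set M : ℝ := max 1 (32 ^ e) * (1 / 8) ^ e
  calc ∫⁻ y in lCone (m + 1), ENNReal.ofReal (|testFun m y| * lDelta (m + 1) y ^ e)
      ≤ ∫⁻ y, (testSet m).indicator (fun _ => ENNReal.ofReal M) y := by
        refine (setLIntegral_le_lintegral _ _).trans (lintegral_mono fun y => ?_)
        by_cases hy : y ∈ testSet m
        · have hb := lDelta_mem_of_mem_testSet hy
          simp only [testFun, Set.indicator_of_mem hy, Pi.one_apply, abs_one, one_mul]
          exact ENNReal.ofReal_le_ofReal (rpow_le_max_mul e (by norm_num) hb.1 hb.2)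
        · simp [testFun, hy]
    _ = ENNReal.ofReal M * volume (testSet m) := by
        rw [lintegral_indicator (isOpen_testSet m).measurableSet, setLIntegral_const]
    _ < ⊤ := ENNReal.mul_lt_top ENNReal.ofReal_lt_top (volume_testSet_lt_top m)

theorem lintegral_testFun_ne_zero (m : ℕ) (β : ℝ) :
    ∫⁻ x in lCone (m + 1), ENNReal.ofReal (|testFun m x| * lDelta (m + 1) x ^ β) ≠ 0 := by
  have h1 := measurable_testFun m
  have h2 := measurable_lDelta (m + 1)
  refine ((setLIntegral_pos_iff (by fun_prop)).2 ?_).ne'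
  refine lt_of_lt_of_le ((isOpen_testSet m).measure_pos volume (testSet_nonempty m))
    (measure_mono fun x hx => ⟨?_, testSet_subset_lCone m hx⟩)
  refine (ENNReal.ofReal_pos.2 ?_).ne'
  simp only [testFun, Set.indicator_of_mem hx, Pi.one_apply, abs_one, one_mul]
  exact Real.rpow_pos_of_pos (testSet_subset_lCone m hx).1 β

theorem Sop_testFun_ge {m : ℕ} {α β γ : ℝ} {y : Fin (m + 1) → ℝ}
    (hr : 1 < ‖spatial y‖) (hu : 0 < y 0 - ‖spatial y‖) (hu2 : y 0 - ‖spatial y‖ < 2) :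
    ENNReal.ofReal (lDelta (m + 1) y ^ α) *
      (ENNReal.ofReal (min 1 (32 ^ (-γ)) * ‖spatial y‖ ^ (-γ)) *
        ∫⁻ x in lCone (m + 1), ENNReal.ofReal (|testFun m x| * lDelta (m + 1) x ^ β)) ≤
    Sop (m + 1) α β γ (testFun m) y := by
  unfold Sop
  gcongr
  rw [← lintegral_const_mul' _ _ ENNReal.ofReal_ne_top]
  refine lintegral_mono fun x => ?_
  simp only
  rw [← ENNReal.ofReal_mul (by positivity)]
  by_cases hx : x ∈ testSet m
  · have hb := lDelta_add_bounds hx hr hu hu2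
    have := Real.rpow_nonneg (testSet_subset_lCone m hx).1.le β
    exact ENNReal.ofReal_le_ofReal (by
      rw [mul_assoc (_ ^ (-γ))]
      gcongr
      exact min_mul_rpow_le _ (by linarith) hb.1 hb.2)
  · simp [testFun, hx]

theorem integrand_testFun_ge {m : ℕ} {α β γ q μ : ℝ} (hq : 0 < q) {y : Fin (m + 1) → ℝ}
    (hr : 1 < ‖spatial y‖) (hu : 0 < y 0 - ‖spatial y‖) (hu2 : y 0 - ‖spatial y‖ < 2) :
    ENNReal.ofReal (min 1 (32 ^ (q * α + μ - ((m + 1 : ℕ) : ℝ) / 2))) *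
      (ENNReal.ofReal (min 1 (32 ^ (-γ))) * ∫⁻ x in lCone (m + 1),
        ENNReal.ofReal (|testFun m x| * lDelta (m + 1) x ^ β)) ^ q *
      (ENNReal.ofReal (‖spatial y‖ ^ (q * α + μ - ((m + 1 : ℕ) : ℝ) / 2 - γ * q)) *
        ENNReal.ofReal ((y 0 - ‖spatial y‖) ^ (q * α + μ - ((m + 1 : ℕ) : ℝ) / 2))) ≤
    Sop (m + 1) α β γ (testFun m) y ^ q *
      ENNReal.ofReal (lDelta (m + 1) y ^ (μ - ((m + 1 : ℕ) : ℝ) / 2)) := by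
  have hS := Sop_testFun_ge (α := α) (β := β) (γ := γ) hr hu hu2
  have hb := lDelta_bounds hr hu hu2
  set κ := ∫⁻ x in lCone (m + 1), ENNReal.ofReal (|testFun m x| * lDelta (m + 1) x ^ β)
  set e := μ - ((m + 1 : ℕ) : ℝ) / 2 with he
  rw [show q * α + μ - ((m + 1 : ℕ) : ℝ) / 2 = q * α + e by rw [he]; ring]
  set r := ‖spatial y‖
  set u := y 0 - r
  set D := lDelta (m + 1) y
  have hr0 : 0 < r := one_pos.trans hr
  have hD : 0 < D := lt_of_lt_of_le (mul_pos hu hr0) hb.1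
  have hlow := min_mul_rpow_le (q * α + e) (mul_pos hu hr0) hb.1 hb.2
  have h32 : (0 : ℝ) ≤ min 1 (32 ^ (-γ)) := by positivity
  have h32' : (0 : ℝ) ≤ min 1 (32 ^ (q * α + e)) := by positivity
  calc _ = ENNReal.ofReal (min 1 (32 ^ (q * α + e)) * (u * r) ^ (q * α + e)) *
        ENNReal.ofReal (r ^ (-γ * q)) * (ENNReal.ofReal (min 1 (32 ^ (-γ))) * κ) ^ q := by
        rw [Real.mul_rpow hu.le hr0.le, sub_eq_add_neg, Real.rpow_add hr0, ENNReal.ofReal_mul h32',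
          ENNReal.ofReal_mul (by positivity), ENNReal.ofReal_mul (by positivity), neg_mul]
        ring
    _ ≤ ENNReal.ofReal (D ^ (q * α + e)) *
        ENNReal.ofReal (r ^ (-γ * q)) * (ENNReal.ofReal (min 1 (32 ^ (-γ))) * κ) ^ q := by
        gcongr
    _ = (ENNReal.ofReal (D ^ α) * (ENNReal.ofReal (min 1 (32 ^ (-γ)) * r ^ (-γ)) * κ)) ^ q *
        ENNReal.ofReal (D ^ e) := by
        rw [ENNReal.ofReal_mul h32, ENNReal.mul_rpow_of_nonneg _ _ hq.le,
          ENNReal.mul_rpow_of_nonneg _ _ hq.le, ENNReal.mul_rpow_of_nonneg _ _ hq.le,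
          ENNReal.mul_rpow_of_nonneg _ _ hq.le,
          ENNReal.ofReal_rpow_of_nonneg (by positivity : 0 ≤ D ^ α) hq.le,
          ENNReal.ofReal_rpow_of_nonneg (by positivity : 0 ≤ r ^ (-γ)) hq.le,
          ← Real.rpow_mul hD.le, ← Real.rpow_mul hr0.le, Real.rpow_add hD, mul_comm q α,
          ENNReal.ofReal_mul (by positivity)]
        ring
    _ ≤ _ := by gcongr

/-- The region of the cone on which the norm of the image of the test function is estimated. -/
def lightRegion (m : ℕ) : Set (Fin (m + 1) → ℝ) :=
  shear ⁻¹' (({z | 1 < ‖z‖} : Set (EuclideanSpace ℝ (Fin m))) ×ˢ Set.Ioo (0 : ℝ) 2)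

theorem isOpen_lightRegion (m : ℕ) : IsOpen (lightRegion m) :=
  ((isOpen_lt continuous_const continuous_norm).prod isOpen_Ioo).preimage continuous_shear

theorem lightRegion_nonempty {m : ℕ} (hm : 1 ≤ m) : (lightRegion m).Nonempty := by
  have : Nonempty (Fin m) := ⟨⟨0, hm⟩⟩
  obtain ⟨z, hz⟩ := NormedSpace.exists_lt_norm ℝ (EuclideanSpace ℝ (Fin m)) 1
  have hs : spatial (Fin.cons (‖z‖ + 1) (WithLp.ofLp z) : Fin (m + 1) → ℝ) = z := by
    simp [spatial]
  refine ⟨Fin.cons (‖z‖ + 1) (WithLp.ofLp z), ?_, ?_⟩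
  · simpa [shear, hs] using hz
  · simp [shear, hs]

theorem exists_mul_lintegral_le_lintegral_Sop_testFun {m : ℕ} {α β γ q μ : ℝ} (hq : 0 < q) :
    ∃ c : ℝ≥0∞, c ≠ 0 ∧
      c * ∫⁻ y in lightRegion m,
        ENNReal.ofReal (‖(shear y).1‖ ^ (q * α + μ - ((m + 1 : ℕ) : ℝ) / 2 - γ * q)) *
          ENNReal.ofReal ((shear y).2 ^ (q * α + μ - ((m + 1 : ℕ) : ℝ) / 2)) ≤
      ∫⁻ y in lCone (m + 1), Sop (m + 1) α β γ (testFun m) y ^ q *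
        ENNReal.ofReal (lDelta (m + 1) y ^ (μ - ((m + 1 : ℕ) : ℝ) / 2)) := by
  have hsub : lightRegion m ⊆ lCone (m + 1) := fun y hy => mem_lCone_iff.2 (sub_pos.1 hy.2.1)
  refine ⟨ENNReal.ofReal (min 1 (32 ^ (q * α + μ - ((m + 1 : ℕ) : ℝ) / 2))) *
      (ENNReal.ofReal (min 1 (32 ^ (-γ))) * ∫⁻ x in lCone (m + 1),
        ENNReal.ofReal (|testFun m x| * lDelta (m + 1) x ^ β)) ^ q, ?_, ?_⟩
  · refine mul_ne_zero (ENNReal.ofReal_pos.2 (by positivity)).ne' fun h0 => ?_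
    rw [ENNReal.rpow_eq_zero_iff_of_pos hq] at h0
    exact mul_ne_zero (ENNReal.ofReal_pos.2 (by positivity)).ne'
      (lintegral_testFun_ne_zero m β) h0
  · rw [← lintegral_const_mul _ (by fun_prop)]
    exact (setLIntegral_mono' (isOpen_lightRegion m).measurableSet fun y hy =>
      integrand_testFun_ge hq hy.1 hy.2.1 hy.2.2).trans (lintegral_mono_set hsub)

theorem bounds_of_SopNorm_testFun_ne_top {m : ℕ} (hm : 1 ≤ m) {α β γ q μ : ℝ} (hq : 0 < q)
    (h : SopNorm (m + 1) α β γ q μ (testFun m) ≠ ⊤) :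
    -1 < q * α + μ - ((m + 1 : ℕ) : ℝ) / 2 ∧
      q * α + μ - ((m + 1 : ℕ) : ℝ) / 2 - γ * q < -m := by
  have hI : ∫⁻ y in lCone (m + 1), Sop (m + 1) α β γ (testFun m) y ^ q *
      ENNReal.ofReal (lDelta (m + 1) y ^ (μ - ((m + 1 : ℕ) : ℝ) / 2)) ≠ ⊤ := by
    intro hI
    rw [SopNorm, hI, ENNReal.top_rpow_of_pos (by positivity)] at h
    exact h rfl
  obtain ⟨c, hc0, hle⟩ := exists_mul_lintegral_le_lintegral_Sop_testFun
    (m := m) (α := α) (β := β) (γ := γ) (μ := μ) hq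
  exact rpow_bounds_of_lintegral_ne_top hm
    (ENNReal.lt_top_of_mul_ne_top_right (ne_top_of_le_ne_top hI hle) hc0).ne

theorem SopNorm_testFun_ne_zero {m : ℕ} (hm : 1 ≤ m) {α β γ q μ : ℝ} (hq : 0 < q) :
    SopNorm (m + 1) α β γ q μ (testFun m) ≠ 0 := by
  obtain ⟨c, hc0, hle⟩ := exists_mul_lintegral_le_lintegral_Sop_testFun
    (m := m) (α := α) (β := β) (γ := γ) (μ := μ) hq
  rw [SopNorm, Ne, ENNReal.rpow_eq_zero_iff_of_pos (by positivity)]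
  intro h
  rw [h, nonpos_iff_eq_zero] at hle
  refine mul_ne_zero hc0 ((setLIntegral_pos_iff (by fun_prop)).2 ?_).ne' hle
  refine ((isOpen_lightRegion m).measure_pos volume (lightRegion_nonempty hm)).trans_le
    (measure_mono fun y hy => ⟨mul_ne_zero ?_ ?_, hy⟩)
  · exact (ENNReal.ofReal_pos.2 (Real.rpow_pos_of_pos (one_pos.trans hy.1) _)).ne'
  · exact (ENNReal.ofReal_pos.2 (Real.rpow_pos_of_pos hy.2.1 _)).ne'

theorem eq_zero_of_forall_rpow_le {e M : ℝ} (h : ∀ T : ℝ, 0 < T → T ^ e ≤ M) : e = 0 := by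
  by_contra he
  have hM : 0 < |M| + 1 := by positivity
  have := h ((|M| + 1) ^ (1 / e)) (by positivity)
  rw [← Real.rpow_mul hM.le, one_div_mul_cancel he, Real.rpow_one] at this
  linarith [le_abs_self M]

theorem homogeneity_of_SBounded {m : ℕ} (hm : 1 ≤ m) {α β γ ν q μ : ℝ} (hq : 0 < q)
    (hS : SBounded (m + 1) α β γ 1 ν q μ) :
    α - γ + β + ((m + 1 : ℕ) : ℝ) / 2 + μ / q - ν = 0 := by
  obtain ⟨C, hC, hS⟩ := hS
  have hfin := coneNorm_testFun_lt_top m ν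
  have ha : SopNorm (m + 1) α β γ q μ (testFun m) ≠ ⊤ := ne_top_of_le_ne_top
    (ENNReal.mul_ne_top ENNReal.ofReal_ne_top hfin.ne) (hS _ (measurable_testFun m) hfin)
  have ha0 := SopNorm_testFun_ne_zero hm (α := α) (β := β) (γ := γ) (μ := μ) hq
  set a := SopNorm (m + 1) α β γ q μ (testFun m)
  set b := coneNorm (m + 1) 1 ν (testFun m)
  set e := α - γ + β + ((m + 1 : ℕ) : ℝ) / 2 + μ / q
  refine eq_zero_of_forall_rpow_le (M := C * b.toReal / a.toReal) fun T hT => ?_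
  have ht : 0 < √T := Real.sqrt_pos.2 hT
  have hb := coneNorm_one_smul (m + 1) (ν := ν) ht (testFun m)
  have hmeas : Measurable fun x => testFun m ((√T)⁻¹ • x) :=
    (measurable_testFun m).comp (measurable_const_smul _)
  have h := hS _ hmeas (by rw [hb]; exact ENNReal.mul_lt_top ENNReal.ofReal_lt_top hfin)
  rw [hb, SopNorm_smul (m + 1) hq ht _ fun y hy x hx => (lCone_add_mem hy hx).1.le,
    Real.sq_sqrt hT.le] at h
  have h' := ENNReal.toReal_mono (ENNReal.mul_ne_top ENNReal.ofReal_ne_top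
    (ENNReal.mul_ne_top ENNReal.ofReal_ne_top hfin.ne)) h
  rw [ENNReal.toReal_mul, ENNReal.toReal_mul, ENNReal.toReal_mul,
    ENNReal.toReal_ofReal (by positivity), ENNReal.toReal_ofReal hC.le,
    ENNReal.toReal_ofReal (by positivity)] at h'
  rw [Real.rpow_sub hT, div_le_div_iff₀ (by positivity) (ENNReal.toReal_pos ha0 ha)]
  calc _ ≤ _ := h'
    _ = _ := by ring

/-- Lemma 4.5 of the paper on the rank-2 Lorentz cone (necessity, `p = 1`). -/
theorem statement14 (n : ℕ) [NeZero n] (hn : 3 ≤ n) (α β γ ν μ q : ℝ)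
    (hq : 1 < q) (hμ : 0 < μ)
    (hS : SBounded n α β γ 1 ν q μ) :
    γ = α + β + (n : ℝ) / 2 - ν + μ / q ∧
      0 < γ ∧
      ((n : ℝ) / 2 - 1 - q * α < μ ∧ μ < q * (γ - α) - (n : ℝ) / 2 + 1) := by
  obtain ⟨m, rfl⟩ : ∃ m, n = m + 1 := ⟨n - 1, by lia⟩
  have hm : (2 : ℝ) ≤ m := by exact_mod_cast (by lia : 2 ≤ m)
  have hq0 : 0 < q := one_pos.trans hq
  have hhom := homogeneity_of_SBounded (by lia) hq0 hS
  obtain ⟨C, hC, hS⟩ := hS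
  have hfin := coneNorm_testFun_lt_top m ν
  have hb := bounds_of_SopNorm_testFun_ne_top (by lia) hq0 (ne_top_of_le_ne_top
    (ENNReal.mul_ne_top ENNReal.ofReal_ne_top hfin.ne) (hS _ (measurable_testFun m) hfin))
  push_cast at hhom hb ⊢
  refine ⟨by linarith, ?_, by linarith, by linarith⟩
  exact pos_of_mul_pos_left (by linarith) hq0.le
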